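/- Let P_1, P_2 be real quadratic polynomials with integer coefficients, leading coefficients b_{1,2}, b_{2,2} with 0 < |b_{1,2}| ≤ |b_{2,2}|, and no common complex root. Suppose P_j has real roots α_{j,1}, α_{j,2} (j = 1,2) with |α_{j,i}| ≤ M for all i,j, and suppose |α_{1,i} - α_{2,i}| ≤ δ_i for i = 1, 2. Then 1 ≤ |b_{1,2}|² |b_{2,2}|² · δ_1 · δ_2 · (2M)². -/

import Mathlib

/-- The explicit resultant of two quadratics, expressed through their roots. -/
theorem quadratic_resultant_eq_prod_roots_sub {R : Type*} [CommRing R] (a d x y z w : R) :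
    (a * (d * (z * w)) - a * (x * y) * d) ^ 2 -
        (a * (-d * (z + w)) - -a * (x + y) * d) *
          (-a * (x + y) * (d * (z * w)) - a * (x * y) * (-d * (z + w))) =
      a ^ 2 * d ^ 2 * ((x - z) * (y - w) * ((x - w) * (y - z))) := by
  ring

/-- Vieta's formulas for a quadratic function given in factored form. -/
theorem quadratic_coeffs_of_factorization {a b c x y : ℝ}
    (h : ∀ t : ℝ, a * t ^ 2 + b * t + c = a * (t - x) * (t - y)) :
    b = -a * (x + y) ∧ c = a * (x * y) := by
  have h₀ := h 0
  have h₁ := h 1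
  constructor <;> linarith

theorem resultant_lower_bound_quadratics
    (b₁₂ b₁₁ b₁₀ b₂₂ b₂₁ b₂₀ : ℤ)
    (α₁₁ α₁₂ α₂₁ α₂₂ M δ₁ δ₂ : ℝ)
    (hb : 0 < |b₁₂| ∧ |b₁₂| ≤ |b₂₂|)
    (hfact₁ : ∀ t : ℝ, (b₁₂ : ℝ) * t ^ 2 + (b₁₁ : ℝ) * t + (b₁₀ : ℝ) =
      (b₁₂ : ℝ) * (t - α₁₁) * (t - α₁₂))
    (hfact₂ : ∀ t : ℝ, (b₂₂ : ℝ) * t ^ 2 + (b₂₁ : ℝ) * t + (b₂₀ : ℝ) =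
      (b₂₂ : ℝ) * (t - α₂₁) * (t - α₂₂))
    (hnocommon : α₁₁ ≠ α₂₁ ∧ α₁₁ ≠ α₂₂ ∧ α₁₂ ≠ α₂₁ ∧ α₁₂ ≠ α₂₂)
    (hM : |α₁₁| ≤ M ∧ |α₁₂| ≤ M ∧ |α₂₁| ≤ M ∧ |α₂₂| ≤ M)
    (hδ₁ : |α₁₁ - α₂₁| ≤ δ₁) (hδ₂ : |α₁₂ - α₂₂| ≤ δ₂) :
    1 ≤ (b₁₂ : ℝ) ^ 2 * (b₂₂ : ℝ) ^ 2 * δ₁ * δ₂ * (2 * M) ^ 2 := by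
  obtain ⟨hb₁₁, hb₁₀⟩ := quadratic_coeffs_of_factorization hfact₁
  obtain ⟨hb₂₁, hb₂₀⟩ := quadratic_coeffs_of_factorization hfact₂
  obtain ⟨h₁₁, h₁₂, h₂₁, h₂₂⟩ := hnocommon
  obtain ⟨hM₁₁, hM₁₂, hM₂₁, hM₂₂⟩ := hM
  have hb₁ : (b₁₂ : ℝ) ≠ 0 := Int.cast_ne_zero.mpr (abs_pos.mp hb.1)
  have hb₂ : (b₂₂ : ℝ) ≠ 0 := Int.cast_ne_zero.mpr (abs_pos.mp (hb.1.trans_le hb.2))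
  set r : ℤ := (b₁₂ * b₂₀ - b₁₀ * b₂₂) ^ 2 -
    (b₁₂ * b₂₁ - b₁₁ * b₂₂) * (b₁₁ * b₂₀ - b₁₀ * b₂₁) with hr
  have hres : (r : ℝ) = (b₁₂ : ℝ) ^ 2 * (b₂₂ : ℝ) ^ 2 *
      ((α₁₁ - α₂₁) * (α₁₂ - α₂₂) * ((α₁₁ - α₂₂) * (α₁₂ - α₂₁))) := by
    rw [hr]
    push_cast
    rw [hb₁₁, hb₁₀, hb₂₁, hb₂₀, quadratic_resultant_eq_prod_roots_sub]
  have hr₀ : r ≠ 0 := by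
    rw [← Int.cast_ne_zero (α := ℝ), hres]
    simp [hb₁, hb₂, sub_eq_zero, h₁₁, h₁₂, h₂₁, h₂₂]
  have hcross₁ : |α₁₁ - α₂₂| ≤ 2 * M := (abs_sub _ _).trans (by linarith)
  have hcross₂ : |α₁₂ - α₂₁| ≤ 2 * M := (abs_sub _ _).trans (by linarith)
  have hM₀ : 0 ≤ 2 * M := (abs_nonneg _).trans hcross₁
  calc (1 : ℝ) ≤ |(r : ℝ)| := by exact_mod_cast Int.one_le_abs hr₀
    _ = (b₁₂ : ℝ) ^ 2 * (b₂₂ : ℝ) ^ 2 *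
        (|α₁₁ - α₂₁| * |α₁₂ - α₂₂| * (|α₁₁ - α₂₂| * |α₁₂ - α₂₁|)) := by
      rw [hres]
      simp only [abs_mul, abs_pow, sq_abs]
    _ ≤ (b₁₂ : ℝ) ^ 2 * (b₂₂ : ℝ) ^ 2 * (δ₁ * δ₂ * (2 * M * (2 * M))) := by
      have hδ₁₀ : 0 ≤ δ₁ := (abs_nonneg _).trans hδ₁
      have hδ₂₀ : 0 ≤ δ₂ := (abs_nonneg _).trans hδ₂
      gcongr
    _ = (b₁₂ : ℝ) ^ 2 * (b₂₂ : ℝ) ^ 2 * δ₁ * δ₂ * (2 * M) ^ 2 := by ring
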